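/- For the Lie algebra 𝔤₄,₁, the curvature tensor R satisfies R₁₂₁₂ = ¼, R₁₂₂₃ = −¼, R₁₄₁₄ = −¼, R₁₄₃₄ = ¼, R₂₃₂₃ = ¼, R₂₄₂₄ = 1, R₃₄₃₄ = ¾, every component R(eᵢ,eⱼ,e_k,e_l) not obtainable from these via the symmetries R(x,y,z,w) = −R(y,x,z,w) = −R(x,y,w,z) = R(z,w,x,y) vanishes, and in particular R ≠ 0, i.e. the manifold is non-flat. -/

import Mathlib

noncomputable section

/-- The underlying 4-dimensional real vector space. -/
abbrev V : Type := Fin 4 → ℝ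

/-- The standard basis e₁,e₂,e₃,e₄ (indexed by 0,1,2,3). -/
def e (i : Fin 4) : V := Pi.single i 1

/-- The neutral metric g with g(e₁,e₁)=g(e₂,e₂)=1, g(e₃,e₃)=g(e₄,e₄)=−1. -/
def gm (x y : V) : ℝ := x 0 * y 0 + x 1 * y 1 - x 2 * y 2 - x 3 * y 3

/-- The signs ε₁=ε₂=1, ε₃=ε₄=−1. -/
def eps : Fin 4 → ℝ := ![1, 1, -1, -1]

/-- J₁ : e₁↦e₂, e₂↦−e₁, e₃↦−e₄, e₄↦e₃. -/
def J1 (x : V) : V := ![-x 1, x 0, x 3, -x 2]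

/-- J₂ : e₁↦e₃, e₂↦e₄, e₃↦−e₁, e₄↦−e₂. -/
def J2 (x : V) : V := ![-x 2, -x 3, x 0, x 1]

/-- J₃ : e₁↦−e₄, e₂↦e₃, e₃↦−e₂, e₄↦e₁. -/
def J3 (x : V) : V := ![x 3, -x 2, x 1, -x 0]

/-- Lie bracket of 𝔤₄,₁ : [e₂,e₄]=e₁, [e₃,e₄]=e₂. -/
def br (x y : V) : V := ![x 1 * y 3 - x 3 * y 1, x 2 * y 3 - x 3 * y 2, 0, 0]

/-- Fundamental tensor F(x,y,z) = g((∇ₓ J)y, z) for an almost complex structure Jm. -/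
def Fa (nab : V →ₗ[ℝ] V →ₗ[ℝ] V) (Jm : V → V) (x y z : V) : ℝ :=
  gm (nab x (Jm y) - Jm (nab x y)) z

/-- Lee form θ(z) = Σᵢ εᵢ F(eᵢ,eᵢ,z). -/
def theta (nab : V →ₗ[ℝ] V →ₗ[ℝ] V) (Jm : V → V) : V → ℝ :=
  fun z => ∑ i, eps i * Fa nab Jm (e i) (e i) z

/-- Curvature operator R(x,y)z = ∇ₓ∇_y z − ∇_y∇ₓ z − ∇_{[x,y]} z. -/
def Rm (nab : V →ₗ[ℝ] V →ₗ[ℝ] V) (x y z : V) : V :=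
  nab x (nab y z) - nab y (nab x z) - nab (br x y) z

/-- Curvature (0,4)-tensor R(x,y,z,w) = g(R(x,y)z, w). -/
def R4 (nab : V →ₗ[ℝ] V →ₗ[ℝ] V) (x y z w : V) : ℝ := gm (Rm nab x y z) w

/-- Ricci tensor ρ(y,z) = Σᵢ εᵢ R(eᵢ,y,z,eᵢ). -/
def ricci (nab : V →ₗ[ℝ] V →ₗ[ℝ] V) (y z : V) : ℝ :=
  ∑ i, eps i * R4 nab (e i) y z (e i)

/-- Scalar curvature τ = Σⱼ εⱼ ρ(eⱼ,eⱼ). -/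
def tau (nab : V →ₗ[ℝ] V →ₗ[ℝ] V) : ℝ := ∑ j, eps j * ricci nab (e j) (e j)

/-- Associated Ricci tensor ρ*(y,z) = Σᵢ εᵢ R(eᵢ,y,z,J eᵢ). -/
def ricciS (nab : V →ₗ[ℝ] V →ₗ[ℝ] V) (Jm : V → V) (y z : V) : ℝ :=
  ∑ i, eps i * R4 nab (e i) y z (Jm (e i))

/-- ∗-scalar curvature τ* = Σⱼ εⱼ ρ*(eⱼ,eⱼ). -/
def tauS (nab : V →ₗ[ℝ] V →ₗ[ℝ] V) (Jm : V → V) : ℝ :=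
  ∑ j, eps j * ricciS nab Jm (e j) (e j)

/-- ∗∗-scalar curvature τ** = Σⱼ εⱼ ρ*(eⱼ,J eⱼ). -/
def tauSS (nab : V →ₗ[ℝ] V →ₗ[ℝ] V) (Jm : V → V) : ℝ :=
  ∑ j, eps j * ricciS nab Jm (e j) (Jm (e j))

/-- Basic sectional curvature k_{ij} = R(eᵢ,eⱼ,eⱼ,eᵢ)/(εᵢεⱼ). -/
def sek (nab : V →ₗ[ℝ] V →ₗ[ℝ] V) (i j : Fin 4) : ℝ :=
  R4 nab (e i) (e j) (e j) (e i) / (eps i * eps j)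

/-- Antisymmetrized Kronecker symbol used to encode curvature-type tensors. -/
def D (a b i j : Fin 4) : ℝ :=
  (if i = a ∧ j = b then (1 : ℝ) else 0) - (if i = b ∧ j = a then (1 : ℝ) else 0)

/-- The expected curvature tensor of 𝔤₄,₁ : nonzero components generated by
R₁₂₁₂=¼, R₁₂₂₃=−¼, R₁₄₁₄=−¼, R₁₄₃₄=¼, R₂₃₂₃=¼, R₂₄₂₄=1, R₃₄₃₄=¾ and the
symmetries R(x,y,z,w) = −R(y,x,z,w) = −R(x,y,w,z) = R(z,w,x,y). -/
def T (i j k l : Fin 4) : ℝ :=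
  (1/4) * D 0 1 i j * D 0 1 k l
  - (1/4) * (D 0 1 i j * D 1 2 k l + D 1 2 i j * D 0 1 k l)
  - (1/4) * D 0 3 i j * D 0 3 k l
  + (1/4) * (D 0 3 i j * D 2 3 k l + D 2 3 i j * D 0 3 k l)
  + (1/4) * D 1 2 i j * D 1 2 k l
  + D 1 3 i j * D 1 3 k l
  + (3/4) * D 2 3 i j * D 2 3 k l

/-- The Koszul formula determines the connection of `𝔤₄,₁` explicitly. -/
theorem nab_eq_of_koszul (nab : V →ₗ[ℝ] V →ₗ[ℝ] V)
    (hK : ∀ x y z : V, 2 * gm (nab x y) z = gm (br x y) z + gm (br z x) y + gm (br z y) x)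
    (x y : V) :
    nab x y = ![(x 1 * y 3 - x 3 * y 1) / 2,
      (x 2 * y 3 - x 3 * y 2 + x 3 * y 0 + x 0 * y 3) / 2,
      -(x 3 * y 1 + x 1 * y 3) / 2,
      (x 1 * y 0 + x 2 * y 1 + x 0 * y 1 + x 1 * y 2) / 2] := by
  ext m
  have h := hK x y (e m)
  fin_cases m <;> simp [gm, br, e] at h ⊢ <;> linarith

/-- The Plücker coordinate of `x ∧ y` in the plane spanned by `e a` and `e b`. -/
def minor (a b : Fin 4) (x y : V) : ℝ := x a * y b - x b * y a

theorem minor_e (a b i j : Fin 4) : minor a b (e i) (e j) = D a b i j := by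
  simp only [minor, D, e, Pi.single_apply, ite_and, eq_comm (a := a), eq_comm (a := b)]
  split_ifs <;> simp

/-- The curvature tensor of `𝔤₄,₁` as a quadratic form in Plücker coordinates. -/
theorem R4_eq_minor (nab : V →ₗ[ℝ] V →ₗ[ℝ] V)
    (hK : ∀ x y z : V, 2 * gm (nab x y) z = gm (br x y) z + gm (br z x) y + gm (br z y) x)
    (x y z w : V) :
    R4 nab x y z w =
      (1/4) * minor 0 1 x y * minor 0 1 z w
      - (1/4) * (minor 0 1 x y * minor 1 2 z w + minor 1 2 x y * minor 0 1 z w)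
      - (1/4) * minor 0 3 x y * minor 0 3 z w
      + (1/4) * (minor 0 3 x y * minor 2 3 z w + minor 2 3 x y * minor 0 3 z w)
      + (1/4) * minor 1 2 x y * minor 1 2 z w
      + minor 1 3 x y * minor 1 3 z w
      + (3/4) * minor 2 3 x y * minor 2 3 z w := by
  simp [R4, Rm, nab_eq_of_koszul nab hK, gm, br, minor]
  ring

theorem stmt_3
    (nab : V →ₗ[ℝ] V →ₗ[ℝ] V)
    (hK : ∀ x y z : V, 2 * gm (nab x y) z = gm (br x y) z + gm (br z x) y + gm (br z y) x) :
    R4 nab (e 0) (e 1) (e 0) (e 1) = 1/4 ∧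
    R4 nab (e 0) (e 1) (e 1) (e 2) = -(1/4) ∧
    R4 nab (e 0) (e 3) (e 0) (e 3) = -(1/4) ∧
    R4 nab (e 0) (e 3) (e 2) (e 3) = 1/4 ∧
    R4 nab (e 1) (e 2) (e 1) (e 2) = 1/4 ∧
    R4 nab (e 1) (e 3) (e 1) (e 3) = 1 ∧
    R4 nab (e 2) (e 3) (e 2) (e 3) = 3/4 ∧
    (∀ i j k l : Fin 4, R4 nab (e i) (e j) (e k) (e l) = T i j k l) ∧
    (∃ x y z w : V, R4 nab x y z w ≠ 0)
  := by
    have hT : ∀ i j k l : Fin 4, R4 nab (e i) (e j) (e k) (e l) = T i j k l := fun i j k l => by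
      simp only [R4_eq_minor nab hK, minor_e, T]
    refine ⟨?_, ?_, ?_, ?_, ?_, ?_, ?_, hT, e 1, e 3, e 1, e 3, ?_⟩ <;>
      rw [hT] <;> simp [T, D]
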